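/- Let x_n, y_n ∈ Ω be sequences converging to a common point of ∂Ω. Then ⟨∇_x H(x_n, y_n), ν_{x_n}⟩ = (1/(2π))·⟨y_n − x̄_n, ν_{x_n}⟩ / |x̄_n − y_n|² + O(1) = (1/(2π))·( d(x_n) + d(y_n) ) / |x̄_n − y_n|² + O(1) as n → ∞, i.e. both differences remain bounded. -/

import Mathlib

open Real Set Metric Filter MeasureTheory

/-- The Laplacian of a real-valued function on the plane ℝ² ≅ ℂ. -/
noncomputable def planeLap (f : ℂ → ℝ) (x : ℂ) : ℝ :=
  fderiv ℝ (fun y => fderiv ℝ f y 1) x 1 +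
  fderiv ℝ (fun y => fderiv ℝ f y Complex.I) x Complex.I

/-- A function is harmonic on a set if it is C² there with vanishing Laplacian. -/
def HarmonicOnSet (f : ℂ → ℝ) (s : Set ℂ) : Prop :=
  ContDiffOn ℝ 2 f s ∧ ∀ x ∈ s, planeLap f x = 0

/-- `RegPart Ω H`: H is the regular part of the Dirichlet Green's function of −Δ on Ω:
for each x ∈ Ω, y ↦ H(x,y) is harmonic on Ω, extends continuously to the closure of Ω,
with boundary values (1/(2π))·log|x−y| on ∂Ω; moreover H is symmetric on Ω × Ω. -/
def RegPart (Ω : Set ℂ) (H : ℂ → ℂ → ℝ) : Prop :=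
  (∀ x ∈ Ω, HarmonicOnSet (fun y => H x y) Ω ∧
      ContinuousOn (fun y => H x y) (closure Ω) ∧
      ∀ y ∈ frontier Ω, H x y = (1 / (2 * π)) * Real.log ‖x - y‖) ∧
  (∀ x ∈ Ω, ∀ y ∈ Ω, H x y = H y x)

/-- The Green's function G(x,y) = (1/(2π))·log(1/|x−y|) + H(x,y). -/
noncomputable def green (H : ℂ → ℂ → ℝ) (x y : ℂ) : ℝ :=
  (1 / (2 * π)) * Real.log (1 / ‖x - y‖) + H x y
/-- The standard inner product on ℝ² ≅ ℂ. -/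
noncomputable def rinner (z w : ℂ) : ℝ := z.re * w.re + z.im * w.im

/-- The collar Ω₀ = {x ∈ Ω : dist(x,∂Ω) < δ₀}. -/
def collar (Ω : Set ℂ) (δ₀ : ℝ) : Set ℂ :=
  {x | x ∈ Ω ∧ Metric.infDist x (frontier Ω) < δ₀}

/-- `Ω has C² boundary`: there are δ₀ > 0 and C₀ > 0 such that the nearest-point
projection onto ∂Ω is well defined and C¹ on the collar Ω₀, and the inward unit
normal ν satisfies |⟨z − w, ν_w⟩| ≤ C₀|z − w|² for w, z ∈ ∂Ω. -/
structure C2Boundary (Ω : Set ℂ) where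
  δ₀ : ℝ
  C₀ : ℝ
  proj : ℂ → ℂ
  ν : ℂ → ℂ
  δ₀_pos : 0 < δ₀
  C₀_pos : 0 < C₀
  proj_mem : ∀ x ∈ collar Ω δ₀, proj x ∈ frontier Ω
  proj_dist : ∀ x ∈ collar Ω δ₀, ‖x - proj x‖ = Metric.infDist x (frontier Ω)
  proj_unique : ∀ x ∈ collar Ω δ₀, ∀ z ∈ frontier Ω,
    ‖x - z‖ = Metric.infDist x (frontier Ω) → z = proj x
  proj_C1 : ContDiffOn ℝ 1 proj (collar Ω δ₀)
  ν_unit : ∀ w ∈ frontier Ω, ‖ν w‖ = 1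
  ν_compat : ∀ x ∈ collar Ω δ₀, ν (proj x) = (‖x - proj x‖)⁻¹ • (x - proj x)
  quad : ∀ w ∈ frontier Ω, ∀ z ∈ frontier Ω, |rinner (z - w) (ν w)| ≤ C₀ * ‖z - w‖ ^ 2

/-- The reflection x̄ = 2p(x) − x of x across ∂Ω. -/
noncomputable def C2Boundary.refl {Ω : Set ℂ} (b : C2Boundary Ω) (x : ℂ) : ℂ :=
  2 * b.proj x - x

/-- The inward unit normal ν_x = (x − p(x))/|x − p(x)| at p(x). -/
noncomputable def C2Boundary.nuAt {Ω : Set ℂ} (b : C2Boundary Ω) (x : ℂ) : ℂ :=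
  (‖x - b.proj x‖)⁻¹ • (x - b.proj x)

open InnerProductSpace in
/-- Functions harmonic on an open set are harmonic in the sense of Mathlib. -/
lemma HarmonicOnSet.harmonicOnNhd {f : ℂ → ℝ} {s : Set ℂ} (hs : IsOpen s)
    (hf : HarmonicOnSet f s) : HarmonicOnNhd f s := by
  intro x hx
  refine ⟨hf.1.contDiffAt (hs.mem_nhds hx), ?_⟩
  filter_upwards [hs.mem_nhds hx] with y hy
  have h2 : ContDiffAt ℝ 2 f y := hf.1.contDiffAt (hs.mem_nhds hy)
  have hd : DifferentiableAt ℝ (fderiv ℝ f) y :=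
    (h2.fderiv_right (m := 1) (by norm_num)).differentiableAt (by norm_num)
  have key : ∀ v : ℂ, fderiv ℝ (fun z => fderiv ℝ f z v) y v = fderiv ℝ (fderiv ℝ f) y v v := by
    intro v
    rw [fderiv_clm_apply hd (differentiableAt_const v)]
    simp
  have h0 := hf.2 y hy
  rw [planeLap, key, key] at h0
  rw [laplacian_eq_iteratedFDeriv_complexPlane]
  simpa [iteratedFDeriv_two_apply] using h0

open InnerProductSpace in
/-- A harmonic function is constant near any of its local maxima. -/
lemma eventually_eq_of_isLocalMax_of_harmonicAt {f : ℂ → ℝ} {c : ℂ} (hf : HarmonicAt f c)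
    (hc : IsLocalMax f c) : ∀ᶠ y in nhds c, f y = f c := by
  obtain ⟨r, hr, hball⟩ := Metric.eventually_nhds_iff_ball.1 hf.eventually
  obtain ⟨F, hF, hre⟩ := HarmonicOnNhd.exists_analyticOnNhd_ball_re_eq (f := f) hball
  have hmem : ∀ᶠ y in nhds c, y ∈ ball c r := ball_mem_nhds c hr
  have hnorm : ∀ y ∈ ball c r, ‖Complex.exp (F y)‖ = Real.exp (f y) := by
    intro y hy
    rw [Complex.norm_exp, ← hre hy]
  have hcm : c ∈ ball c r := mem_ball_self hr
  have hconst : ∀ᶠ y in nhds c, Complex.exp (F y) = Complex.exp (F c) := by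
    refine Complex.eventually_eq_of_isLocalMax_norm (f := fun y => Complex.exp (F y)) ?_ ?_
    · filter_upwards [hmem] with y hy
      exact (hF y hy).differentiableAt.cexp
    · filter_upwards [hmem, hc] with y hy hle
      simp only [Function.comp_apply]
      rw [hnorm y hy, hnorm c hcm]
      exact Real.exp_le_exp.2 hle
  filter_upwards [hmem, hconst] with y hy he
  have h := congrArg norm he
  rw [hnorm y hy, hnorm c hcm] at h
  exact Real.exp_injective h

open InnerProductSpace in
/-- Weak maximum principle for harmonic functions on bounded planar open sets. -/
lemma le_of_harmonicOnNhd_of_frontier_le {f : ℂ → ℝ} {Ω : Set ℂ} (hΩo : IsOpen Ω)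
    (hΩb : Bornology.IsBounded Ω) (hf : HarmonicOnNhd f Ω) (hcont : ContinuousOn f (closure Ω))
    {M : ℝ} (hM : ∀ z ∈ frontier Ω, f z ≤ M) : ∀ z ∈ Ω, f z ≤ M := by
  intro z hz
  have hcpt : IsCompact (closure Ω) := hΩb.isCompact_closure
  obtain ⟨c, hcΩ, hmax⟩ := hcpt.exists_isMaxOn ⟨z, subset_closure hz⟩ hcont
  refine (hmax (subset_closure hz)).trans ?_
  by_contra! hlt
  set K : Set ℂ := {y ∈ closure Ω | f y = f c} with hK
  have hKΩ : K ⊆ Ω := by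
    rintro y ⟨hy, hyc⟩
    by_contra hyΩ
    have := hM y (by rw [hΩo.frontier_eq]; exact ⟨hy, hyΩ⟩)
    linarith
  have hKclosed : IsClosed K := by
    have := hcont.preimage_isClosed_of_isClosed isClosed_closure (isClosed_singleton (x := f c))
    exact this
  have hKopen : IsOpen K := by
    rw [isOpen_iff_mem_nhds]
    intro y hy
    have hyΩ := hΩo.mem_nhds (hKΩ hy)
    have hloc : IsLocalMax f y := by
      filter_upwards [hyΩ] with u hu
      rw [hy.2]
      exact hmax (subset_closure hu)
    filter_upwards [hyΩ, eventually_eq_of_isLocalMax_of_harmonicAt (hf y (hKΩ hy)) hloc]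
      with u hu hfu
    exact ⟨subset_closure hu, hfu.trans hy.2⟩
  rcases isClopen_iff.1 ⟨hKclosed, hKopen⟩ with h | h
  · exact (h ▸ (⟨hcΩ, rfl⟩ : c ∈ K) : c ∈ (∅ : Set ℂ))
  · exact NormedSpace.unbounded_univ ℝ ℂ (h ▸ hΩb.subset hKΩ)

open InnerProductSpace in
lemma abs_le_of_harmonicOnNhd_of_frontier_abs_le {f : ℂ → ℝ} {Ω : Set ℂ} (hΩo : IsOpen Ω)
    (hΩb : Bornology.IsBounded Ω) (hf : HarmonicOnNhd f Ω) (hcont : ContinuousOn f (closure Ω))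
    {M : ℝ} (hM : ∀ z ∈ frontier Ω, |f z| ≤ M) : ∀ z ∈ Ω, |f z| ≤ M := by
  intro z hz
  refine abs_le'.2 ⟨le_of_harmonicOnNhd_of_frontier_le hΩo hΩb hf hcont
    (fun u hu => (abs_le'.1 (hM u hu)).1) z hz, ?_⟩
  exact le_of_harmonicOnNhd_of_frontier_le hΩo hΩb hf.neg hcont.neg
    (fun u hu => (abs_le'.1 (hM u hu)).2) z hz

lemma sq_norm_eq_rinner (z : ℂ) : ‖z‖ ^ 2 = rinner z z := by
  rw [Complex.sq_norm, Complex.normSq_apply, rinner]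

lemma sq_norm_add_smul (a : ℂ) {n : ℂ} (hn : ‖n‖ = 1) (t : ℝ) :
    ‖a + t • n‖ ^ 2 = ‖a‖ ^ 2 + 2 * t * rinner a n + t ^ 2 := by
  have h : rinner n n = 1 := by rw [← sq_norm_eq_rinner, hn, one_pow]
  simp only [sq_norm_eq_rinner]
  simp only [rinner, Complex.add_re, Complex.add_im, Complex.real_smul, Complex.re_ofReal_mul,
    Complex.im_ofReal_mul] at *
  linear_combination t ^ 2 * h

lemma rinner_add_smul (a : ℂ) {n : ℂ} (hn : ‖n‖ = 1) (t : ℝ) :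
    rinner (a + t • n) n = rinner a n + t := by
  have h : rinner n n = 1 := by rw [← sq_norm_eq_rinner, hn, one_pow]
  simp only [rinner, Complex.add_re, Complex.add_im, Complex.real_smul, Complex.re_ofReal_mul,
    Complex.im_ofReal_mul] at *
  linear_combination t * h

/-- The dipole field with pole `c` is harmonic away from `c`. -/
lemma harmonicAt_dipole (c n : ℂ) {y : ℂ} (hy : y ≠ c) :
    InnerProductSpace.HarmonicAt (fun y => rinner (y - c) n / ‖c - y‖ ^ 2) y := by
  have h : AnalyticAt ℂ (fun y => n / (y - c)) y :=
    analyticAt_const.div (analyticAt_id.sub analyticAt_const) (sub_ne_zero.2 hy)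
  have heq : (fun y => rinner (y - c) n / ‖c - y‖ ^ 2) = fun y => (n / (y - c)).re := by
    ext z
    rw [Complex.div_re, norm_sub_rev, Complex.sq_norm, rinner]
    ring
  rw [heq]
  exact h.harmonicAt_re

/-- The difference of the normal derivatives of the fundamental solution and of its image by
reflection stays bounded where the tangency defect `s` is quadratically small. -/
lemma abs_dipole_sub_reflected_le {C d r s : ℝ} (hC0 : 0 ≤ C) (hd : 0 < d)
    (hr : 0 ≤ r) (hdC : d * C ≤ 1 / 4) (hs : |s| ≤ C * r) :
    |(d - s) / (r - 2 * d * s + d ^ 2) - (s + d) / (r + 2 * d * s + d ^ 2)| ≤ 8 * C := by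
  obtain ⟨hs1, hs2⟩ := abs_le.1 hs
  set A := r + d ^ 2 with hA
  have hd2 : 0 < d ^ 2 := by positivity
  have hApos : 0 < A := by positivity
  have hds1 : d * s ≤ A / 4 := by nlinarith
  have hds2 : -(A / 4) ≤ d * s := by nlinarith
  have e1 : r - 2 * d * s + d ^ 2 = A - 2 * (d * s) := by rw [hA]; ring
  have e2 : r + 2 * d * s + d ^ 2 = A + 2 * (d * s) := by rw [hA]; ring
  have hp1 : 0 < A - 2 * (d * s) := by linarith
  have hp2 : 0 < A + 2 * (d * s) := by linarith
  rw [e1, e2, div_sub_div _ _ hp1.ne' hp2.ne', abs_div, abs_of_pos (mul_pos hp1 hp2),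
    div_le_iff₀ (mul_pos hp1 hp2)]
  have hnum : (d - s) * (A + 2 * (d * s)) - (A - 2 * (d * s)) * (s + d)
      = s * (4 * d ^ 2 - 2 * A) := by ring
  have hCA : |s| ≤ C * A := hs.trans (by nlinarith)
  have hfac : |4 * d ^ 2 - 2 * A| ≤ 2 * A := abs_le.2 ⟨by nlinarith, by nlinarith⟩
  rw [hnum, abs_mul]
  have hden : 3 / 4 * A ^ 2 ≤ (A - 2 * (d * s)) * (A + 2 * (d * s)) := by
    nlinarith [mul_nonneg (sub_nonneg.2 hds1) (sub_nonneg.2 hds2)]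
  calc |s| * |4 * d ^ 2 - 2 * A| ≤ C * A * (2 * A) := by gcongr
    _ ≤ 8 * C * (3 / 4 * A ^ 2) := by nlinarith [mul_nonneg hC0 (sq_nonneg A)]
    _ ≤ _ := by gcongr

namespace C2Boundary

variable {Ω : Set ℂ} (b : C2Boundary Ω)

/-- The radius of the two balls tangent to the boundary at a given point that contain no
boundary points. -/
noncomputable def tangentRadius : ℝ := (2 * b.C₀)⁻¹

lemma tangentRadius_pos : 0 < b.tangentRadius :=
  inv_pos.2 (mul_pos two_pos b.C₀_pos)

lemma tangentRadius_mul : b.C₀ * b.tangentRadius = 1 / 2 := by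
  have := b.C₀_pos.ne'
  rw [tangentRadius]
  field_simp

lemma notMem_frontier_of_mem_ball {w z : ℂ} (hw : w ∈ frontier Ω) {σ : ℝ} (hσ : |σ| = 1)
    (hz : z ∈ ball (w + (σ * b.tangentRadius) • b.ν w) b.tangentRadius) : z ∉ frontier Ω := by
  intro hzf
  have hR := b.tangentRadius_pos
  have hCR := b.tangentRadius_mul
  have hq := b.quad w hw z hzf
  rw [mem_ball, dist_eq_norm, ← sq_lt_sq₀ (norm_nonneg _) hR.le] at hz
  have e : z - (w + (σ * b.tangentRadius) • b.ν w)
      = (z - w) + (-(σ * b.tangentRadius)) • b.ν w := by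
    rw [neg_smul]; ring
  rw [e, sq_norm_add_smul _ (b.ν_unit w hw)] at hz
  have hσ2 : σ ^ 2 = 1 := by rw [← sq_abs, hσ, one_pow]
  have hle : σ * rinner (z - w) (b.ν w) ≤ b.C₀ * ‖z - w‖ ^ 2 := by
    refine (le_abs_self _).trans ?_
    rwa [abs_mul, hσ, one_mul]
  have hmul := mul_le_mul_of_nonneg_left hle hR.le
  have h1 : b.tangentRadius * (b.C₀ * ‖z - w‖ ^ 2) = ‖z - w‖ ^ 2 / 2 := by
    linear_combination ‖z - w‖ ^ 2 * hCR
  nlinarith [congrArg (fun t => t * b.tangentRadius ^ 2) hσ2]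

lemma ball_subset_of_inter_nonempty (hΩo : IsOpen Ω) {w : ℂ} (hw : w ∈ frontier Ω) {σ : ℝ}
    (hσ : |σ| = 1)
    (h : (ball (w + (σ * b.tangentRadius) • b.ν w) b.tangentRadius ∩ Ω).Nonempty) :
    ball (w + (σ * b.tangentRadius) • b.ν w) b.tangentRadius ⊆ Ω := by
  refine (convex_ball _ _).isPreconnected.subset_of_closure_inter_subset hΩo h ?_
  rintro z ⟨hz, hzb⟩
  by_contra hzΩ
  exact b.notMem_frontier_of_mem_ball hw hσ hzb (by rw [hΩo.frontier_eq]; exact ⟨hz, hzΩ⟩)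

variable {b} {x : ℂ}

lemma infDist_pos (hΩo : IsOpen Ω) (hx : x ∈ collar Ω b.δ₀) : 0 < infDist x (frontier Ω) := by
  refine (isClosed_frontier.notMem_iff_infDist_pos ⟨_, b.proj_mem x hx⟩).1 ?_
  rw [hΩo.frontier_eq]
  exact fun h => h.2 hx.1

lemma nuAt_eq (hx : x ∈ collar Ω b.δ₀) : b.nuAt x = b.ν (b.proj x) :=
  (b.ν_compat x hx).symm

lemma eq_proj_add_smul (hΩo : IsOpen Ω) (hx : x ∈ collar Ω b.δ₀) :
    x = b.proj x + infDist x (frontier Ω) • b.ν (b.proj x) := by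
  have hd := infDist_pos hΩo hx
  rw [b.ν_compat x hx, b.proj_dist x hx, smul_smul, mul_inv_cancel₀ hd.ne', one_smul]
  ring

lemma mem_ball_of_collar (hΩo : IsOpen Ω) (hx : x ∈ collar Ω b.δ₀)
    (hd : infDist x (frontier Ω) * b.C₀ ≤ 1 / 4) :
    x ∈ ball (b.proj x + (1 * b.tangentRadius) • b.ν (b.proj x)) b.tangentRadius := by
  have hpos := infDist_pos hΩo hx
  have hR := b.tangentRadius_pos
  have hCR := b.tangentRadius_mul
  have hdR : infDist x (frontier Ω) ≤ b.tangentRadius := by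
    have := b.C₀_pos
    by_contra! h
    nlinarith
  have e : x - (b.proj x + (1 * b.tangentRadius) • b.ν (b.proj x))
      = (infDist x (frontier Ω) - b.tangentRadius) • b.ν (b.proj x) := by
    conv_lhs => enter [1]; rw [eq_proj_add_smul hΩo hx]
    rw [one_mul, sub_smul]; ring
  rw [mem_ball, dist_eq_norm, e, norm_smul, b.ν_unit _ (b.proj_mem x hx), mul_one,
    Real.norm_eq_abs, abs_lt]
  constructor <;> linarith

lemma interior_ball_subset (hΩo : IsOpen Ω) (hx : x ∈ collar Ω b.δ₀)
    (hd : infDist x (frontier Ω) * b.C₀ ≤ 1 / 4) :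
    ball (b.proj x + (1 * b.tangentRadius) • b.ν (b.proj x)) b.tangentRadius ⊆ Ω :=
  b.ball_subset_of_inter_nonempty hΩo (b.proj_mem x hx) abs_one
    ⟨x, mem_ball_of_collar hΩo hx hd, hx.1⟩

/-- The exterior tangent ball misses `Ω`: otherwise its points near the boundary would have the
same projection as `x` with opposite normal. -/
lemma exterior_ball_disjoint (hΩo : IsOpen Ω) (hx : x ∈ collar Ω b.δ₀) :
    Disjoint (ball (b.proj x + (-1 * b.tangentRadius) • b.ν (b.proj x)) b.tangentRadius) Ω := by
  rw [Set.disjoint_iff_inter_eq_empty]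
  by_contra hne
  have hw := b.proj_mem x hx
  have hσ : |(-1 : ℝ)| = 1 := by simp
  have hsub := b.ball_subset_of_inter_nonempty hΩo hw hσ (Set.nonempty_iff_ne_empty.2 hne)
  set w := b.proj x with hwdef
  have hn := b.ν_unit w hw
  have hR := b.tangentRadius_pos
  have hδ := b.δ₀_pos
  obtain ⟨t, ht0, htR, htδ⟩ : ∃ t, 0 < t ∧ t ≤ b.tangentRadius ∧ t < b.δ₀ :=
    ⟨min b.tangentRadius (b.δ₀ / 2), lt_min hR (half_pos hδ), min_le_left _ _,
      (min_le_right _ _).trans_lt (half_lt_self hδ)⟩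
  set u : ℂ := w + (-t) • b.ν w with hu
  have huc : dist u (w + (-1 * b.tangentRadius) • b.ν w) = b.tangentRadius - t := by
    have e : u - (w + (-1 * b.tangentRadius) • b.ν w) = (b.tangentRadius - t) • b.ν w := by
      simp only [hu, sub_smul, neg_smul, neg_one_mul]; ring
    rw [dist_eq_norm, e, norm_smul, hn, mul_one, Real.norm_eq_abs, abs_of_nonneg (by linarith)]
  have huw : ‖u - w‖ = t := by
    rw [hu, add_sub_cancel_left, norm_smul, hn, mul_one, Real.norm_eq_abs, abs_neg,
      abs_of_pos ht0]
  have hdist : infDist u (frontier Ω) = t := by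
    refine le_antisymm ((infDist_le_dist_of_mem hw).trans_eq (by rw [dist_eq_norm, huw])) ?_
    refine (le_infDist ⟨w, hw⟩).2 fun z hz => ?_
    have hzb : b.tangentRadius ≤ dist z (w + (-1 * b.tangentRadius) • b.ν w) := by
      by_contra! h
      exact b.notMem_frontier_of_mem_ball hw hσ (mem_ball.2 h) hz
    have := dist_triangle_left z (w + (-1 * b.tangentRadius) • b.ν w) u
    linarith
  have hucol : u ∈ collar Ω b.δ₀ := by
    refine ⟨hsub ?_, hdist ▸ htδ⟩
    rw [mem_ball, huc]
    linarith
  have hup : w = b.proj u := b.proj_unique u hucol w hw (by rw [huw, hdist])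
  have hν := b.ν_compat u hucol
  rw [← hup, huw, hu, add_sub_cancel_left, smul_smul, mul_neg, inv_mul_cancel₀ ht0.ne',
    neg_one_smul] at hν
  have h0 : b.ν w = 0 := self_eq_neg.1 hν
  rw [h0, norm_zero] at hn
  exact zero_ne_one hn

lemma refl_eq (hΩo : IsOpen Ω) (hx : x ∈ collar Ω b.δ₀) :
    b.refl x = b.proj x + (-infDist x (frontier Ω)) • b.ν (b.proj x) := by
  rw [refl]
  conv_lhs => enter [2]; rw [eq_proj_add_smul hΩo hx]
  rw [neg_smul]; ring

lemma refl_notMem_closure (hΩo : IsOpen Ω) (hx : x ∈ collar Ω b.δ₀)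
    (hd : infDist x (frontier Ω) * b.C₀ ≤ 1 / 4) : b.refl x ∉ closure Ω := by
  have hball : b.refl x ∈ ball (b.proj x + (-1 * b.tangentRadius) • b.ν (b.proj x))
      b.tangentRadius := by
    have h := mem_ball_of_collar hΩo hx hd
    rw [mem_ball, dist_eq_norm] at h ⊢
    have e : b.refl x - (b.proj x + (-1 * b.tangentRadius) • b.ν (b.proj x))
        = -(x - (b.proj x + (1 * b.tangentRadius) • b.ν (b.proj x))) := by
      rw [refl, neg_one_mul, one_mul, neg_smul]
      ring
    rwa [e, norm_neg]
  exact Set.disjoint_left.1 ((exterior_ball_disjoint hΩo hx).closure_right isOpen_ball) hball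

/-- Lipschitz continuity of the unit normal at projections of points near the boundary,
phrased through the angle between two normals. -/
lemma abs_rinner_nu_nu_sub_one_le (hΩo : IsOpen Ω) {y : ℂ} (hx : x ∈ collar Ω b.δ₀)
    (hy : y ∈ collar Ω b.δ₀) (hdx : infDist x (frontier Ω) * b.C₀ ≤ 1 / 4)
    (hdy : infDist y (frontier Ω) * b.C₀ ≤ 1 / 4) :
    |rinner (b.ν (b.proj y)) (b.ν (b.proj x)) - 1| ≤
      2 * b.C₀ ^ 2 * ‖b.proj y - b.proj x‖ ^ 2 := by
  have hR := b.tangentRadius_pos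
  have hCR := b.tangentRadius_mul
  have sep : ∀ {x y : ℂ}, x ∈ collar Ω b.δ₀ → y ∈ collar Ω b.δ₀ →
      infDist x (frontier Ω) * b.C₀ ≤ 1 / 4 → (2 * b.tangentRadius) ^ 2 ≤
      ‖(b.proj y - b.proj x) - b.tangentRadius • (b.ν (b.proj y) + b.ν (b.proj x))‖ ^ 2 := by
    intro x y hx hy hdx
    have hdisj := (exterior_ball_disjoint hΩo hy).mono_right (interior_ball_subset hΩo hx hdx)
    have h := (disjoint_ball_ball_iff hR hR).1 hdisj
    rw [dist_eq_norm] at h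
    have e : b.proj y + (-1 * b.tangentRadius) • b.ν (b.proj y)
        - (b.proj x + (1 * b.tangentRadius) • b.ν (b.proj x))
        = (b.proj y - b.proj x) - b.tangentRadius • (b.ν (b.proj y) + b.ν (b.proj x)) := by
      rw [neg_one_mul, one_mul, neg_smul, smul_add]; ring
    rw [e] at h
    gcongr
    linarith
  have h1 := sep hx hy hdx
  have h2 := sep hy hx hdy
  have hnx : rinner (b.ν (b.proj x)) (b.ν (b.proj x)) = 1 := by
    rw [← sq_norm_eq_rinner, b.ν_unit _ (b.proj_mem x hx), one_pow]
  have hny : rinner (b.ν (b.proj y)) (b.ν (b.proj y)) = 1 := by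
    rw [← sq_norm_eq_rinner, b.ν_unit _ (b.proj_mem y hy), one_pow]
  generalize b.ν (b.proj x) = n at *
  generalize b.ν (b.proj y) = m at *
  generalize b.proj y = q at *
  generalize b.proj x = w at *
  generalize b.tangentRadius = R at *
  have hC := b.C₀_pos
  have hle : rinner m n ≤ 1 := by
    simp only [rinner] at *
    nlinarith [sq_nonneg (m.re - n.re), sq_nonneg (m.im - n.im)]
  have hge : 4 * R ^ 2 * (1 - rinner m n) ≤ 2 * ‖q - w‖ ^ 2 := by
    rw [sq_norm_eq_rinner] at h1 h2 ⊢
    simp only [rinner, Complex.add_re, Complex.add_im, Complex.sub_re, Complex.sub_im,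
      Complex.real_smul, Complex.re_ofReal_mul, Complex.im_ofReal_mul] at *
    have e1 : R ^ 2 * (m.re * m.re + m.im * m.im) = R ^ 2 := by rw [hny, mul_one]
    have e2 : R ^ 2 * (n.re * n.re + n.im * n.im) = R ^ 2 := by rw [hnx, mul_one]
    nlinarith
  rw [abs_of_nonpos (by linarith), neg_sub]
  have h4 : 4 * b.C₀ ^ 2 * R ^ 2 = 1 := by
    linear_combination (4 * b.C₀ * R + 2) * hCR
  have := mul_le_mul_of_nonneg_left hge (sq_nonneg b.C₀)
  nlinarith

lemma sq_norm_proj_sub_le (hΩo : IsOpen Ω) {y : ℂ} (hx : x ∈ collar Ω b.δ₀)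
    (hy : y ∈ collar Ω b.δ₀) (hdx : infDist x (frontier Ω) * b.C₀ ≤ 1 / 8)
    (hdy : infDist y (frontier Ω) * b.C₀ ≤ 1 / 8) :
    ‖b.proj y - b.proj x‖ ^ 2 ≤ 2 * ‖b.refl x - y‖ ^ 2 := by
  have hpx := b.proj_mem x hx
  have hpy := b.proj_mem y hy
  have hq1 := (abs_le.1 (b.quad _ hpx _ hpy)).1
  have hq2 := (abs_le.1 (b.quad _ hpy _ hpx)).2
  have hdx0 := infDist_pos hΩo hx
  have hdy0 := infDist_pos hΩo hy
  have e : b.refl x - y = -((b.proj y - b.proj x)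
      + infDist y (frontier Ω) • b.ν (b.proj y) + infDist x (frontier Ω) • b.ν (b.proj x)) := by
    rw [refl_eq hΩo hx, neg_smul]
    conv_lhs => enter [2]; rw [eq_proj_add_smul hΩo hy]
    ring
  rw [norm_sub_rev (b.proj x)] at hq2
  rw [e, norm_neg]
  generalize infDist x (frontier Ω) = s at *
  generalize infDist y (frontier Ω) = t at *
  generalize b.ν (b.proj x) = n at *
  generalize b.ν (b.proj y) = m at *
  generalize b.proj y = q at *
  generalize b.proj x = w at *
  have hsq : ‖q - w + t • m + s • n‖ ^ 2 = ‖q - w‖ ^ 2 + ‖t • m + s • n‖ ^ 2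
      + 2 * s * rinner (q - w) n - 2 * t * rinner (w - q) m := by
    simp only [sq_norm_eq_rinner]
    simp only [rinner, Complex.add_re, Complex.add_im, Complex.sub_re, Complex.sub_im,
      Complex.real_smul, Complex.re_ofReal_mul, Complex.im_ofReal_mul]
    ring
  rw [hsq]
  have h1 := mul_le_mul_of_nonneg_left hq1 hdx0.le
  have h2 := mul_le_mul_of_nonneg_left hq2 hdy0.le
  have h3 := mul_le_mul_of_nonneg_right hdx (sq_nonneg ‖q - w‖)
  have h4 := mul_le_mul_of_nonneg_right hdy (sq_nonneg ‖q - w‖)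
  nlinarith [sq_nonneg ‖t • m + s • n‖]

/-- The normal component of `y - x̄` is the sum of the boundary distances, up to a quadratically
small error. -/
lemma abs_rinner_sub_refl_sub_le (hΩo : IsOpen Ω) {y : ℂ} (hx : x ∈ collar Ω b.δ₀)
    (hy : y ∈ collar Ω b.δ₀) (hdx : infDist x (frontier Ω) * b.C₀ ≤ 1 / 8)
    (hdy : infDist y (frontier Ω) * b.C₀ ≤ 1 / 8) :
    |rinner (y - b.refl x) (b.nuAt x) - (infDist x (frontier Ω) + infDist y (frontier Ω))| ≤
      3 * b.C₀ * ‖b.refl x - y‖ ^ 2 := by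
  have hpx := b.proj_mem x hx
  have hq := b.quad _ hpx _ (b.proj_mem y hy)
  have hproj := sq_norm_proj_sub_le hΩo hx hy hdx hdy
  have hdy0 := infDist_pos hΩo hy
  have hC := b.C₀_pos
  have hν := abs_rinner_nu_nu_sub_one_le hΩo hx hy (by linarith) (by linarith)
  have e : y - b.refl x = (b.proj y - b.proj x + infDist y (frontier Ω) • b.ν (b.proj y))
      + infDist x (frontier Ω) • b.ν (b.proj x) := by
    rw [refl_eq hΩo hx, neg_smul]
    conv_lhs => enter [1]; rw [eq_proj_add_smul hΩo hy]
    ring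
  have key : rinner (y - b.refl x) (b.nuAt x) - (infDist x (frontier Ω) + infDist y (frontier Ω))
      = rinner (b.proj y - b.proj x) (b.ν (b.proj x))
        + infDist y (frontier Ω) * (rinner (b.ν (b.proj y)) (b.ν (b.proj x)) - 1) := by
    rw [nuAt_eq hx, e, rinner_add_smul _ (b.ν_unit _ hpx)]
    simp only [rinner, Complex.add_re, Complex.add_im, Complex.real_smul, Complex.re_ofReal_mul,
      Complex.im_ofReal_mul]
    ring
  rw [key]
  refine (abs_add_le _ _).trans ?_
  rw [abs_mul, abs_of_pos hdy0]
  have h1 := mul_le_mul_of_nonneg_left hν hdy0.le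
  have h2 := mul_le_mul_of_nonneg_right hdy
    (mul_nonneg hC.le (sq_nonneg ‖b.proj y - b.proj x‖))
  have h3 := mul_le_mul_of_nonneg_left hproj hC.le
  nlinarith

/-- The regular part of the Green's function has, near the boundary, the normal derivative of the
reflected fundamental solution up to a uniformly bounded error. -/
lemma abs_fderiv_sub_reflected_le (hΩo : IsOpen Ω) (hΩb : Bornology.IsBounded Ω)
    {H : ℂ → ℂ → ℝ}
    (hDH : ∀ x ∈ Ω, ∀ v ∈ ({1, Complex.I} : Set ℂ),
      HarmonicOnSet (fun y => fderiv ℝ (fun x' => H x' y) x v) Ω ∧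
      ContinuousOn (fun y => fderiv ℝ (fun x' => H x' y) x v) (closure Ω) ∧
      ∀ y ∈ frontier Ω,
        fderiv ℝ (fun x' => H x' y) x v = (1 / (2 * π)) * rinner (x - y) v / ‖x - y‖ ^ 2)
    (hx : x ∈ collar Ω b.δ₀) (hd : infDist x (frontier Ω) * b.C₀ ≤ 1 / 4) {y : ℂ} (hy : y ∈ Ω) :
    |fderiv ℝ (fun x' => H x' y) x (b.nuAt x) -
      (1 / (2 * π)) * rinner (y - b.refl x) (b.nuAt x) / ‖b.refl x - y‖ ^ 2| ≤
      1 / (2 * π) * (8 * b.C₀) := by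
  obtain ⟨h1, c1, f1⟩ := hDH x hx.1 1 (by simp)
  obtain ⟨h2, c2, f2⟩ := hDH x hx.1 Complex.I (by simp)
  have hpx := b.proj_mem x hx
  have hn := b.ν_unit _ hpx
  rw [nuAt_eq hx]
  set n := b.ν (b.proj x) with hndef
  have hrefl := refl_notMem_closure hΩo hx hd
  have hne : ∀ z ∈ closure Ω, z ≠ b.refl x := fun z hz h => hrefl (h ▸ hz)
  have hdecomp : ∀ z, fderiv ℝ (fun x' => H x' z) x n
      = n.re * fderiv ℝ (fun x' => H x' z) x 1
        + n.im * fderiv ℝ (fun x' => H x' z) x Complex.I := by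
    intro z
    conv_lhs => rw [show n = n.re • (1 : ℂ) + n.im • Complex.I by
      simp [Complex.re_add_im]]
    rw [map_add, map_smul, map_smul, smul_eq_mul, smul_eq_mul]
  have hdip : InnerProductSpace.HarmonicOnNhd
      (fun z => rinner (z - b.refl x) n / ‖b.refl x - z‖ ^ 2) (closure Ω) :=
    fun z hz => harmonicAt_dipole _ _ (hne z hz)
  let g : ℂ → ℝ := (n.re • (fun z => fderiv ℝ (fun x' => H x' z) x 1)
      + n.im • (fun z => fderiv ℝ (fun x' => H x' z) x Complex.I))
      - (1 / (2 * π)) • (fun z => rinner (z - b.refl x) n / ‖b.refl x - z‖ ^ 2)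
  have hg : ∀ z, g z = fderiv ℝ (fun x' => H x' z) x n -
      (1 / (2 * π)) * rinner (z - b.refl x) n / ‖b.refl x - z‖ ^ 2 := by
    intro z
    rw [hdecomp, mul_div_assoc]
    rfl
  rw [← hg]
  refine abs_le_of_harmonicOnNhd_of_frontier_abs_le (f := g) hΩo hΩb ?_ ?_ ?_ y hy
  · exact (((h1.harmonicOnNhd hΩo).const_smul).add ((h2.harmonicOnNhd hΩo).const_smul)).sub
      ((hdip.mono subset_closure).const_smul)
  · exact ((c1.const_smul n.re).add (c2.const_smul n.im)).sub
      (hdip.continuousOn.const_smul (1 / (2 * π)))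
  · intro z hz
    have hx' := eq_proj_add_smul hΩo hx
    have hquad := b.quad _ hpx z hz
    rw [← hndef] at hx' hquad
    have hbound := abs_dipole_sub_reflected_le b.C₀_pos.le (infDist_pos hΩo hx)
      (sq_nonneg ‖z - b.proj x‖) hd hquad
    have e1 : z - x = (z - b.proj x) + (-infDist x (frontier Ω)) • n := by
      conv_lhs => enter [2]; rw [hx']
      rw [neg_smul]; ring
    have e2 : z - b.refl x = (z - b.proj x) + infDist x (frontier Ω) • n := by
      rw [refl_eq hΩo hx, neg_smul]; ring
    have r1 : rinner (x - z) n = infDist x (frontier Ω) - rinner (z - b.proj x) n := by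
      have h := rinner_add_smul (z - b.proj x) hn (-infDist x (frontier Ω))
      rw [← e1] at h
      simp only [rinner, Complex.sub_re, Complex.sub_im] at h ⊢
      linarith
    have hval : g z = 1 / (2 * π) * ((infDist x (frontier Ω) - rinner (z - b.proj x) n) /
        (‖z - b.proj x‖ ^ 2 - 2 * infDist x (frontier Ω) * rinner (z - b.proj x) n
          + infDist x (frontier Ω) ^ 2)
        - (rinner (z - b.proj x) n + infDist x (frontier Ω)) /
        (‖z - b.proj x‖ ^ 2 + 2 * infDist x (frontier Ω) * rinner (z - b.proj x) n
          + infDist x (frontier Ω) ^ 2)) := by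
      rw [hg, hdecomp, f1 z hz, f2 z hz, ← r1, norm_sub_rev x z, norm_sub_rev _ z, e2,
        rinner_add_smul _ hn, sq_norm_add_smul _ hn, e1, sq_norm_add_smul _ hn]
      simp only [rinner, Complex.one_re, Complex.one_im, Complex.I_re, Complex.I_im]
      ring
    rw [hval, abs_mul, abs_of_pos (by positivity)]
    gcongr

end C2Boundary

/-- if x_n, y_n ∈ Ω converge to a common boundary point, then
⟨∇_x H(x_n,y_n), ν_{x_n}⟩ = (1/(2π))⟨y_n − x̄_n, ν_{x_n}⟩/|x̄_n − y_n|² + O(1)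
= (1/(2π))(d(x_n)+d(y_n))/|x̄_n − y_n|² + O(1). -/
theorem normal_derivative_along_sequences (Ω : Set ℂ) (hΩo : IsOpen Ω)
    (hΩc : IsConnected Ω) (hΩb : Bornology.IsBounded Ω) (b : C2Boundary Ω)
    (H : ℂ → ℂ → ℝ) (hH : RegPart Ω H)
    (hdiff : ∀ y ∈ Ω, ∀ x ∈ Ω, DifferentiableAt ℝ (fun x' => H x' y) x)
    (hDH : ∀ x ∈ Ω, ∀ v ∈ ({1, Complex.I} : Set ℂ),
      HarmonicOnSet (fun y => fderiv ℝ (fun x' => H x' y) x v) Ω ∧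
      ContinuousOn (fun y => fderiv ℝ (fun x' => H x' y) x v) (closure Ω) ∧
      ∀ y ∈ frontier Ω,
        fderiv ℝ (fun x' => H x' y) x v = (1 / (2 * π)) * rinner (x - y) v / ‖x - y‖ ^ 2)
    (xs ys : ℕ → ℂ) (hxs : ∀ n, xs n ∈ Ω) (hys : ∀ n, ys n ∈ Ω) (ζ : ℂ)
    (hζ : ζ ∈ frontier Ω) (hx : Filter.Tendsto xs Filter.atTop (nhds ζ))
    (hy : Filter.Tendsto ys Filter.atTop (nhds ζ)) :
    ∃ C : ℝ, ∀ n,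
      |fderiv ℝ (fun x' => H x' (ys n)) (xs n) (b.nuAt (xs n)) -
          (1 / (2 * π)) * rinner (ys n - b.refl (xs n)) (b.nuAt (xs n)) /
            ‖b.refl (xs n) - ys n‖ ^ 2| ≤ C ∧
      |fderiv ℝ (fun x' => H x' (ys n)) (xs n) (b.nuAt (xs n)) -
          (1 / (2 * π)) *
            (Metric.infDist (xs n) (frontier Ω) + Metric.infDist (ys n) (frontier Ω)) /
            ‖b.refl (xs n) - ys n‖ ^ 2| ≤ C := by
  have hev : ∀ {u : ℕ → ℂ}, (∀ n, u n ∈ Ω) → Tendsto u atTop (nhds ζ) →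
      ∀ᶠ n in atTop, u n ∈ collar Ω b.δ₀ ∧ infDist (u n) (frontier Ω) * b.C₀ ≤ 1 / 8 := by
    intro u hu hlim
    have h0 : Tendsto (fun n => infDist (u n) (frontier Ω)) atTop (nhds 0) := by
      have := ((continuous_infDist_pt (frontier Ω)).tendsto ζ).comp hlim
      rwa [infDist_zero_of_mem hζ] at this
    have h1 : Tendsto (fun n => infDist (u n) (frontier Ω) * b.C₀) atTop (nhds 0) := by
      simpa using h0.mul_const b.C₀
    filter_upwards [h0.eventually_lt_const b.δ₀_pos,
      h1.eventually_le_const (by norm_num : (0 : ℝ) < 1 / 8)] with n hn1 hn2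
    exact ⟨⟨hu n, hn1⟩, hn2⟩
  obtain ⟨N, hN⟩ := eventually_atTop.1 ((hev hxs hx).and (hev hys hy))
  set F₁ : ℕ → ℝ := fun n => |fderiv ℝ (fun x' => H x' (ys n)) (xs n) (b.nuAt (xs n)) -
          (1 / (2 * π)) * rinner (ys n - b.refl (xs n)) (b.nuAt (xs n)) /
            ‖b.refl (xs n) - ys n‖ ^ 2| with hF₁
  set F₂ : ℕ → ℝ := fun n => |fderiv ℝ (fun x' => H x' (ys n)) (xs n) (b.nuAt (xs n)) -
          (1 / (2 * π)) *
            (Metric.infDist (xs n) (frontier Ω) + Metric.infDist (ys n) (frontier Ω)) /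
            ‖b.refl (xs n) - ys n‖ ^ 2| with hF₂
  have hπ : 0 < 1 / (2 * π) := by positivity
  have hC := b.C₀_pos
  have htail : ∀ n, N ≤ n → F₁ n ≤ 1 / (2 * π) * (11 * b.C₀) ∧
      F₂ n ≤ 1 / (2 * π) * (11 * b.C₀) := by
    intro n hn
    obtain ⟨⟨hxc, hxd⟩, hyc, hyd⟩ := hN n hn
    have hb := C2Boundary.abs_fderiv_sub_reflected_le hΩo hΩb hDH hxc (by linarith) (hys n)
    have hq := C2Boundary.abs_rinner_sub_refl_sub_le hΩo hxc hyc hxd hyd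
    have hdiv : |(1 / (2 * π)) * rinner (ys n - b.refl (xs n)) (b.nuAt (xs n)) /
        ‖b.refl (xs n) - ys n‖ ^ 2 - (1 / (2 * π)) *
          (infDist (xs n) (frontier Ω) + infDist (ys n) (frontier Ω)) /
            ‖b.refl (xs n) - ys n‖ ^ 2| ≤ 1 / (2 * π) * (3 * b.C₀) := by
      rw [← sub_div, ← mul_sub, mul_div_assoc, abs_mul, abs_of_pos hπ, abs_div,
        abs_of_nonneg (sq_nonneg ‖b.refl (xs n) - ys n‖)]
      gcongr
      exact div_le_of_le_mul₀ (sq_nonneg _) (by positivity) hq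
    constructor
    · exact hb.trans (by gcongr; norm_num)
    · refine (abs_sub_le _ _ _).trans ((add_le_add hb hdiv).trans_eq ?_)
      ring
  refine ⟨1 / (2 * π) * (11 * b.C₀) + ∑ k ∈ Finset.range N, (F₁ k + F₂ k), fun n => ?_⟩
  have hnn : ∀ k, 0 ≤ F₁ k ∧ 0 ≤ F₂ k := fun k => ⟨abs_nonneg _, abs_nonneg _⟩
  have hsum0 : 0 ≤ ∑ k ∈ Finset.range N, (F₁ k + F₂ k) :=
    Finset.sum_nonneg fun k _ => add_nonneg (hnn k).1 (hnn k).2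
  suffices h : F₁ n ≤ 1 / (2 * π) * (11 * b.C₀) + ∑ k ∈ Finset.range N, (F₁ k + F₂ k) ∧
      F₂ n ≤ 1 / (2 * π) * (11 * b.C₀) + ∑ k ∈ Finset.range N, (F₁ k + F₂ k) from h
  rcases le_or_gt N n with hn | hn
  · obtain ⟨h1, h2⟩ := htail n hn
    constructor <;> linarith
  · have hle := Finset.single_le_sum (f := fun k => F₁ k + F₂ k)
      (fun k _ => add_nonneg (hnn k).1 (hnn k).2) (Finset.mem_range.2 hn)
    have h0 : 0 ≤ 1 / (2 * π) * (11 * b.C₀) := by positivity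
    have hF := hnn n
    constructor <;> linarith
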